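/- Let the Euclidean plane ℝ² be coloured in red and blue so that there is no red ℓ₂ and no blue ℓ₅. If A, B, C are three red points forming an equilateral triangle with side length √3, then there exists a set S of six red points, containing {A, B, C} as a subset, that forms a congruent copy of the configuration 𝔗₆. -/

import Mathlib

/-- The two colours. -/
inductive Color
  | red
  | blue

/-- The Euclidean plane ℝ². -/
abbrev Plane : Type := EuclideanSpace ℝ (Fin 2)

/-- The point of the plane with coordinates `(x, y)`. -/
noncomputable def pt (x y : ℝ) : Plane := (WithLp.equiv 2 (Fin 2 → ℝ)).symm ![x, y]

/-- There is no red ℓ₂, i.e. no two red points at Euclidean distance 1. -/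
def NoRedL2 (c : Plane → Color) : Prop :=
  ∀ x y : Plane, c x = Color.red → c y = Color.red → dist x y ≠ 1

/-- There is a blue ℓ₅: a point `p` and a unit vector `w` such that
`p, p+w, p+2w, p+3w, p+4w` are all blue. -/
def HasBlueL5 (c : Plane → Color) : Prop :=
  ∃ p w : Plane, ‖w‖ = 1 ∧ ∀ i : Fin 5, c (p + (i : ℝ) • w) = Color.blue

/-- The configuration 𝔗₆. -/
noncomputable def T6 : Set Plane :=
  {pt 0 0, pt (3 / 2) (Real.sqrt 3 / 2), pt (3 / 2) (-(Real.sqrt 3 / 2)), pt 3 0,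
    pt 3 (Real.sqrt 3), pt 3 (-(Real.sqrt 3))}

/-- The primitive sixth root of unity `exp(iπ/3)`. -/
noncomputable def sixthRoot : ℂ := ⟨1 / 2, √3 / 2⟩

/-- The rotation which moves every vector of length `√3` by distance `1`. -/
noncomputable def spindleRot : ℂ := ⟨5 / 6, √11 / 6⟩

/-- The lattice point `a + bω + cη + dωη`, where `ω = sixthRoot` and `η = spindleRot`. -/
noncomputable def lat (a b c d : ℤ) : ℂ :=
  a + b * sixthRoot + (c + d * sixthRoot) * spindleRot

lemma sixthRoot_sq : sixthRoot ^ 2 = sixthRoot - 1 := by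
  have h3 : √3 * √3 = 3 := Real.mul_self_sqrt (by norm_num)
  apply Complex.ext <;> simp [sixthRoot, pow_two] <;> nlinarith

lemma normSq_lat (a b c d : ℤ) :
    Complex.normSq (lat a b c d) = a ^ 2 + a * b + b ^ 2 + (c ^ 2 + c * d + d ^ 2) +
      5 / 3 * (a * c + b * d + (a * d + b * c) / 2) + √3 * √11 / 6 * (b * c - a * d) := by
  have h3 : √3 ^ 2 = 3 := Real.sq_sqrt (by norm_num)
  have h11 : √11 ^ 2 = 11 := Real.sq_sqrt (by norm_num)
  simp only [lat, sixthRoot, spindleRot, Complex.normSq_apply, Complex.add_re, Complex.add_im,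
    Complex.mul_re, Complex.mul_im, Complex.intCast_re, Complex.intCast_im]
  ring_nf
  simp only [h3, h11]
  ring

lemma norm_lat_eq_one {a b c d : ℤ} (h : b * c = a * d)
    (h' : 3 * (a ^ 2 + a * b + b ^ 2 + (c ^ 2 + c * d + d ^ 2)) +
      5 * (a * c + b * d + a * d) = 3) : ‖lat a b c d‖ = 1 := by
  have e : (b * c : ℝ) = a * d := mod_cast h
  have e' : 3 * (a ^ 2 + a * b + b ^ 2 + (c ^ 2 + c * d + d ^ 2)) +
      5 * (a * c + b * d + a * d) = (3 : ℝ) := mod_cast h'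
  have hN : Complex.normSq (lat a b c d) = 1 := by
    rw [normSq_lat, e]
    linarith
  rw [Complex.normSq_eq_norm_sq] at hN
  exact (pow_eq_one_iff_of_nonneg (norm_nonneg _) two_ne_zero).1 hN

/-- A set of (red) complex numbers with no two elements at distance `1`, meeting every
`ℓ₅`. -/
structure AvoidsL2MeetsL5 (red : ℂ → Prop) : Prop where
  norm_sub_ne_one : ∀ x y, red x → red y → ‖x - y‖ ≠ 1
  exists_mem_line : ∀ p u, ‖u‖ = 1 → ∃ i : Fin 5, red (p + (i : ℂ) * u)

namespace AvoidsL2MeetsL5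

variable {red : ℂ → Prop}

lemma comp_mul_add (h : AvoidsL2MeetsL5 red) (o : ℂ) {a : ℂ} (ha : ‖a‖ = 1) :
    AvoidsL2MeetsL5 fun z => red (o + a * z) where
  norm_sub_ne_one x y hx hy hxy := h.norm_sub_ne_one _ _ hx hy <| by
    rw [add_sub_add_left_eq_sub, ← mul_sub, norm_mul, ha, hxy, one_mul]
  exists_mem_line p u hu := by
    obtain ⟨i, hi⟩ := h.exists_mem_line (o + a * p) (a * u) (by rw [norm_mul, ha, hu, one_mul])
    exact ⟨i, by convert hi using 1; ring⟩

lemma not_red_lat (h : AvoidsL2MeetsL5 red) {a b c d a' b' c' d' : ℤ} (hr : red (lat a b c d))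
    (h₁ : (b - b') * (c - c') = (a - a') * (d - d') := by decide)
    (h₂ : 3 * ((a - a') ^ 2 + (a - a') * (b - b') + (b - b') ^ 2 +
        ((c - c') ^ 2 + (c - c') * (d - d') + (d - d') ^ 2)) +
      5 * ((a - a') * (c - c') + (b - b') * (d - d') + (a - a') * (d - d')) = 3 := by decide) :
    ¬ red (lat a' b' c' d') := fun hr' => h.norm_sub_ne_one _ _ hr hr' <| by
  rw [← norm_lat_eq_one h₁ h₂]
  congr 1
  simp only [lat]
  push_cast
  ring

lemma red_lat_line (h : AvoidsL2MeetsL5 red) (a b c d a' b' c' d' : ℤ)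
    (h₁ : b' * c' = a' * d' := by decide)
    (h₂ : 3 * (a' ^ 2 + a' * b' + b' ^ 2 + (c' ^ 2 + c' * d' + d' ^ 2)) +
      5 * (a' * c' + b' * d' + a' * d') = 3 := by decide) :
    red (lat a b c d) ∨ red (lat (a + a') (b + b') (c + c') (d + d')) ∨
      red (lat (a + 2 * a') (b + 2 * b') (c + 2 * c') (d + 2 * d')) ∨
      red (lat (a + 3 * a') (b + 3 * b') (c + 3 * c') (d + 3 * d')) ∨
      red (lat (a + 4 * a') (b + 4 * b') (c + 4 * c') (d + 4 * d')) := by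
  have key (n : ℤ) : lat a b c d + n * lat a' b' c' d' =
      lat (a + n * a') (b + n * b') (c + n * c') (d + n * d') := by
    simp only [lat]
    push_cast
    ring
  obtain ⟨i, hi⟩ := h.exists_mem_line (lat a b c d) _ (norm_lat_eq_one h₁ h₂)
  have hk := key i
  push_cast at hk
  rw [hk] at hi
  fin_cases i <;> simp at hi <;> simp [hi]

/-- If the triangle `1, ω², -ω` is red, then the point `-2` is not. -/
lemma not_red_neg_two (h : AvoidsL2MeetsL5 red) (hA : red (lat 1 0 0 0))
    (hB : red (lat (-1) 1 0 0)) (hC : red (lat 0 (-1) 0 0)) : ¬ red (lat (-2) 0 0 0) := by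
  intro hD
  have h₁ : red (lat (-1) 1 (-2) (-1)) := by
    have := h.red_lat_line (-1) 1 (-2) (-1) 0 0 1 0
    norm_num at this
    simpa only [h.not_red_lat hD (a' := -1) (b' := 1) (c' := -1) (d' := -1),
      h.not_red_lat hB (a' := -1) (b' := 1) (c' := 0) (d' := -1),
      h.not_red_lat hB (a' := -1) (b' := 1) (c' := 1) (d' := -1),
      h.not_red_lat hA (a' := -1) (b' := 1) (c' := 2) (d' := -1), or_false] using this
  have h₂ : red (lat 0 (-1) (-3) 1) := by
    have := h.red_lat_line 0 (-1) (-3) 1 0 0 1 0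
    norm_num at this
    simpa only [h.not_red_lat hD (a' := 0) (b' := -1) (c' := -2) (d' := 1),
      h.not_red_lat hC (a' := 0) (b' := -1) (c' := -1) (d' := 1),
      h.not_red_lat hC (a' := 0) (b' := -1) (c' := 0) (d' := 1),
      h.not_red_lat hA (a' := 0) (b' := -1) (c' := 1) (d' := 1), or_false] using this
  exact absurd h₂ (h.not_red_lat h₁)

lemma not_red_triangle_lat (h : AvoidsL2MeetsL5 red) (hA : red (lat 1 0 0 0))
    (hB : red (lat (-1) 1 0 0)) (hC : red (lat 0 (-1) 0 0)) : False := by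
  have hmul : ∀ a b : ℤ, lat (-1) 1 0 0 * lat a b 0 0 = lat (-a - b) a 0 0 := by
    intro a b
    simp only [lat]
    push_cast
    linear_combination b * sixthRoot_sq
  have hmul' : ∀ a b : ℤ, lat 0 (-1) 0 0 * lat a b 0 0 = lat b (-a - b) 0 0 := by
    intro a b
    simp only [lat]
    push_cast
    linear_combination -b * sixthRoot_sq
  have hA' : ¬ red (lat (-2) 0 0 0) := h.not_red_neg_two hA hB hC
  have hB' : ¬ red (lat 2 (-2) 0 0) := by
    simpa [hmul] using (h.comp_mul_add 0
      (norm_lat_eq_one (a := -1) (b := 1) (c := 0) (d := 0) rfl rfl)).not_red_neg_two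
      (by simpa [hmul] using hB) (by simpa [hmul] using hC) (by simpa [hmul] using hA)
  have hC' : ¬ red (lat 0 2 0 0) := by
    simpa [hmul'] using (h.comp_mul_add 0
      (norm_lat_eq_one (a := 0) (b := -1) (c := 0) (d := 0) rfl rfl)).not_red_neg_two
      (by simpa [hmul'] using hC) (by simpa [hmul'] using hA) (by simpa [hmul'] using hB)
  have h₁ : ¬ red (lat (-1) (-2) 0 0) := by
    have := h.red_lat_line (-2) (-2) 0 0 0 1 0 0
    norm_num at this
    simp only [hA', h.not_red_lat hB (a' := -2) (b' := 1) (c' := 0) (d' := 0),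
      h.not_red_lat hB (a' := -2) (b' := 2) (c' := 0) (d' := 0), or_false] at this
    rcases this with hr | hr <;> exact h.not_red_lat hr
  have h₂ : ¬ red (lat 3 (-2) 0 0) := by
    have := h.red_lat_line 0 2 0 0 1 (-1) 0 0
    norm_num at this
    simp only [hC', h.not_red_lat hA (a' := 1) (b' := 1) (c' := 0) (d' := 0),
      h.not_red_lat hA (a' := 2) (b' := 0) (c' := 0) (d' := 0), false_or] at this
    rcases this with hr | hr <;> exact h.not_red_lat hr
  have := h.red_lat_line (-1) (-2) 0 0 1 0 0 0
  norm_num at this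
  simp only [h₁, h₂, hB', h.not_red_lat hC (a' := 0) (b' := -2) (c' := 0) (d' := 0),
    h.not_red_lat hC (a' := 1) (b' := -2) (c' := 0) (d' := 0), or_false] at this

lemma not_red_triangle (h : AvoidsL2MeetsL5 red) {A B C : ℂ} (hA : red A) (hB : red B)
    (hC : red C) (hAB : ‖B - A‖ = √3) (hABC : C - A = sixthRoot * (B - A)) : False := by
  set a : ℂ := -(lat 1 1 0 0 / 3 * (B - A)) with ha
  have hl : ‖lat 1 1 0 0‖ = √3 := by
    rw [Complex.norm_def, normSq_lat]
    norm_num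
  have hna : ‖a‖ = 1 := by
    have h3 : √3 * √3 = 3 := Real.mul_self_sqrt (by norm_num)
    rw [ha, norm_neg, norm_mul, norm_div, hl, hAB, Complex.norm_ofNat]
    linarith
  refine (h.comp_mul_add (A - a) hna).not_red_triangle_lat ?_ ?_ ?_
  · convert hA using 1
    simp [lat]
  · convert hB using 1
    simp only [ha, lat]
    push_cast
    linear_combination -(B - A) / 3 * sixthRoot_sq
  · convert hC using 1
    simp only [ha, lat]
    push_cast
    linear_combination (B - A) / 3 * sixthRoot_sq - hABC

end AvoidsL2MeetsL5

lemma eq_sixthRoot_mul_or {p q : ℂ} (hp : ‖p‖ = √3) (hq : ‖q‖ = √3) (hpq : ‖p - q‖ = √3) :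
    q = sixthRoot * p ∨ p = sixthRoot * q := by
  have h3 : √3 ^ 2 = 3 := Real.sq_sqrt (by norm_num)
  have hsq {z : ℂ} (hz : ‖z‖ = √3) : z.re * z.re + z.im * z.im = 3 := by
    rw [← Complex.normSq_apply, Complex.normSq_eq_norm_sq, hz, h3]
  have hp' := hsq hp
  have hq' := hsq hq
  have hpq' := hsq hpq
  rw [Complex.sub_re, Complex.sub_im] at hpq'
  have hdot : p.re * q.re + p.im * q.im = 3 / 2 := by linarith
  have hdet : (p.re * q.im - p.im * q.re - 3 * √3 / 2) *
      (p.re * q.im - p.im * q.re + 3 * √3 / 2) = 0 := by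
    linear_combination (q.re * q.re + q.im * q.im) * hp' + 3 * hq' -
      (p.re * q.re + p.im * q.im + 3 / 2) * hdot - 9 / 4 * h3
  rcases mul_eq_zero.1 hdet with hd | hd
  · left
    apply Complex.ext <;> simp only [sixthRoot, Complex.mul_re, Complex.mul_im]
    · linear_combination -q.re / 3 * hp' + p.re / 3 * hdot - p.im / 3 * hd
    · linear_combination -q.im / 3 * hp' + p.im / 3 * hdot + p.re / 3 * hd
  · right
    apply Complex.ext <;> simp only [sixthRoot, Complex.mul_re, Complex.mul_im]
    · linear_combination -p.re / 3 * hq' + q.re / 3 * hdot + q.im / 3 * hd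
    · linear_combination -p.im / 3 * hq' + q.im / 3 * hdot - q.re / 3 * hd

lemma AvoidsL2MeetsL5.of_coloring {c : Plane → Color} (hred : NoRedL2 c) (hblue : ¬ HasBlueL5 c)
    (e : ℂ ≃ₗᵢ[ℝ] Plane) : AvoidsL2MeetsL5 fun z => c (e z) = Color.red where
  norm_sub_ne_one x y hx hy hxy := hred _ _ hx hy <| by rw [e.dist_map, dist_eq_norm, hxy]
  exists_mem_line p u hu := by
    by_contra! hne
    refine hblue ⟨e p, e u, by rw [e.norm_map, hu], fun i => ?_⟩
    have hi := hne i
    have he : e (p + (i : ℂ) * u) = e p + (i : ℝ) • e u := by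
      rw [map_add, ← map_smul, Complex.real_smul]
      simp
    rw [he] at hi
    cases hc : c (e p + (i : ℝ) • e u) with
    | red => exact absurd hc hi
    | blue => rfl

/-- no red ℓ₂ and no blue ℓ₅; if A, B, C are red points forming an
equilateral triangle of side √3, then there is a set S of six red points
containing {A, B, C} that forms a congruent copy of 𝔗₆. -/
theorem stmt_7 (c : Plane → Color) (hred : NoRedL2 c) (hblue : ¬ HasBlueL5 c)
    (A B C : Plane) (hA : c A = Color.red) (hB : c B = Color.red) (hC : c C = Color.red)
    (hAB : dist A B = Real.sqrt 3) (hBC : dist B C = Real.sqrt 3)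
    (hAC : dist A C = Real.sqrt 3) :
    ∃ S : Set Plane, {A, B, C} ⊆ S ∧ (∀ x ∈ S, c x = Color.red) ∧
      ∃ f : Plane ≃ᵢ Plane, f '' T6 = S := by
  exfalso
  let e : ℂ ≃ₗᵢ[ℝ] Plane := Complex.orthonormalBasisOneI.repr
  have h := AvoidsL2MeetsL5.of_coloring hred hblue e
  obtain ⟨A, rfl⟩ := e.surjective A
  obtain ⟨B, rfl⟩ := e.surjective B
  obtain ⟨C, rfl⟩ := e.surjective C
  rw [e.dist_map, dist_comm, dist_eq_norm] at hAB hAC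
  rw [e.dist_map, dist_eq_norm, ← sub_sub_sub_cancel_right B C A] at hBC
  rcases eq_sixthRoot_mul_or hAB hAC hBC with hq | hp
  · exact h.not_red_triangle hA hB hC hAB hq
  · exact h.not_red_triangle hA hC hB hAC hp
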